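/- Let (Ω, 𝓕, ℙ) be a probability space, (Θ, dist) a metric space, and τ a nonempty finite index set. For each n ∈ ℕ and t ∈ τ, let Q_{n,t} : Θ × Ω → ℝ be a random objective function, let Q*_t : Θ → ℝ be a limit function with a designated point θ*_t ∈ Θ, and let P_n : Θ → ℝ be a penalty with P_n(θ) ≥ 0 for all θ. Assume: (B1–B2, separation) for every ε > 0 there exists δ > 0 such that for all t ∈ τ and all θ ∈ Θ with dist(θ, θ*_t) ≥ ε one has Q*_t(θ) ≤ Q*_t(θ*_t) − δ; (B3, uniform convergence in probability) there exist measurable D_n : Ω → ℝ with sup_{t ∈ τ} sup_{θ ∈ Θ} |Q_{n,t}(θ, ω) − Q*_t(θ)| ≤ D_n(ω) for all ω ∈ Ω and, for every η > 0, ℙ(D_n > η) → 0 as n → ∞; (B4, penalty) max_{t ∈ τ} P_n(θ*_t) → 0 as n → ∞; and suppose there are measurable maps θ̂_{n,t} : Ω → Θ such that for all ω ∈ Ω and θ ∈ Θ, Q_{n,t}(θ̂_{n,t}(ω), ω) − P_n(θ̂_{n,t}(ω)) ≥ Q_{n,t}(θ, ω) − P_n(θ). Then the penalized maximizers are uniformly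 consistent: for every ε > 0, ℙ(max_{t ∈ τ} dist(θ̂_{n,t}, θ*_t) ≥ ε) → 0 as n → ∞. -/

import Mathlib

open MeasureTheory Filter

/-- Lemma A.2 of the paper: uniform consistency of penalized maximizers along the IC path. -/
theorem stmt_1 {Ω : Type*} [MeasurableSpace Ω] (ℙ : Measure Ω) [IsProbabilityMeasure ℙ]
    {Θ : Type*} [MetricSpace Θ] [MeasurableSpace Θ]
    {τ : Type*} [Fintype τ] [Nonempty τ]
    (Q : ℕ → τ → Θ → Ω → ℝ) (Qstar : τ → Θ → ℝ) (θstar : τ → Θ)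
    (P : ℕ → Θ → ℝ) (hP : ∀ n θ, 0 ≤ P n θ)
    -- (B1-B2) separation of the unique maximizers
    (hsep : ∀ ε > (0 : ℝ), ∃ δ > (0 : ℝ), ∀ t, ∀ θ : Θ,
      ε ≤ dist θ (θstar t) → Qstar t θ ≤ Qstar t (θstar t) - δ)
    -- (B3) uniform convergence in probability
    (D : ℕ → Ω → ℝ) (hDmeas : ∀ n, Measurable (D n))
    (hDbound : ∀ n ω t θ, |Q n t θ ω - Qstar t θ| ≤ D n ω)
    (hDtend : ∀ η > (0 : ℝ), Tendsto (fun n => ℙ {ω | η < D n ω}) atTop (nhds 0))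
    -- (B4) penalty vanishes at the ideal maximizers
    (hpen : Tendsto (fun n => Finset.univ.sup' Finset.univ_nonempty
      (fun t => P n (θstar t))) atTop (nhds 0))
    -- penalized maximizers
    (θhat : ℕ → τ → Ω → Θ) (hθhatmeas : ∀ n t, Measurable (θhat n t))
    (hmax : ∀ n t ω, ∀ θ : Θ,
      Q n t θ ω - P n θ ≤ Q n t (θhat n t ω) ω - P n (θhat n t ω)) :
    ∀ ε > (0 : ℝ),
      Tendsto (fun n => ℙ {ω | ε ≤ Finset.univ.sup' Finset.univ_nonempty
        (fun t => dist (θhat n t ω) (θstar t))}) atTop (nhds 0) := by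
  intro ε hε
  obtain ⟨δ, hδ, hsepδ⟩ := hsep ε hε
  refine tendsto_of_tendsto_of_tendsto_of_le_of_le' tendsto_const_nhds
    (hDtend (δ / 4) (by positivity)) (Eventually.of_forall fun _ => zero_le) ?_
  filter_upwards [hpen.eventually_lt_const (half_pos hδ)] with n hn
  refine measure_mono fun ω hω => ?_
  obtain ⟨t, -, ht⟩ := (Finset.le_sup'_iff _).1 (Set.mem_ofPred_eq ▸ hω)
  have hpenalty : P n (θstar t) < δ / 2 := (Finset.sup'_lt_iff _).1 hn t (Finset.mem_univ t)
  have hgap := hsepδ t _ ht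
  have hopt := hmax n t ω (θstar t)
  have hnonneg := hP n (θhat n t ω)
  have hstar := (abs_le.1 (hDbound n ω t (θstar t))).1
  have hhat := (abs_le.1 (hDbound n ω t (θhat n t ω))).2
  change δ / 4 < D n ω
  linarith
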